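/- (Maximally nonlocal theories cannot be maximally random.) Let P_obs be a behaviour in NS for the Bell scenario (N, M, d), and suppose P_obs = ∑_{i ∈ I} q_i • P_i is any finite convex decomposition of P_obs into extreme points of NS (I a finite index type, q_i ≥ 0, ∑_i q_i = 1, each P_i ∈ Set.extremePoints ℝ NS). Then for every input string x₀ : Fin N → Fin M, the guessing probability of this decomposition satisfies ∑_{i ∈ I} q_i * (max_{a : Fin N → Fin d} P_i x₀ a) ≥ 1 / (d^N − (d−1)^N), where the maximum is over the (nonempty) finite type of output strings. -/

import Mathlib

open Finset

/-- The set of no-signaling behaviours for the Bell scenario `(N, M, d)`. -/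
def nsBehaviours (N M d : ℕ) : Set ((Fin N → Fin M) → (Fin N → Fin d) → ℝ) :=
  {P | (∀ x a, 0 ≤ P x a) ∧ (∀ x, ∑ a, P x a = 1) ∧
    (∀ k : Fin N, ∀ x x' : Fin N → Fin M, (∀ j, j ≠ k → x j = x' j) →
      ∀ a : Fin N → Fin d,
        ∑ b : Fin d, P x (Function.update a k b) =
          ∑ b : Fin d, P x' (Function.update a k b))}

/-- One-party perturbation vector. -/
def nsF {e : ℕ} (b : Fin e) (a : Fin (e + 1)) : ℝ :=
  (if a = b.castSucc then 1 else 0) - (if a = Fin.last e then 1 else 0)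

lemma nsF_sum {e : ℕ} (b : Fin e) : ∑ a, nsF b a = 0 := by
  simp [nsF, Finset.sum_sub_distrib]

lemma nsF_castSucc {e : ℕ} (b c : Fin e) : nsF b c.castSucc = if c = b then 1 else 0 := by
  simp [nsF, (Fin.castSucc_lt_last c).ne]

/-- Full perturbation, as a linear map. -/
def nsD (N e : ℕ) : ((Fin N → Fin e) → ℝ) →ₗ[ℝ] ((Fin N → Fin (e + 1)) → ℝ) where
  toFun c a := ∑ b, c b * ∏ k, nsF (b k) (a k)
  map_add' c c' := by
    funext a
    simp [add_mul, Finset.sum_add_distrib]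
  map_smul' r c := by
    funext a
    simp [Finset.mul_sum, mul_assoc]

lemma nsD_castSucc {N e : ℕ} (c : (Fin N → Fin e) → ℝ) (b : Fin N → Fin e) :
    nsD N e c (fun k => (b k).castSucc) = c b := by
  have h : ∀ b' : Fin N → Fin e,
      c b' * ∏ k, nsF (b' k) ((b k).castSucc) = if b' = b then c b' else 0 := by
    intro b'
    simp only [nsF_castSucc]
    split_ifs with hb
    · subst hb; simp
    · obtain ⟨k, hk⟩ := Function.ne_iff.1 hb
      rw [Finset.prod_eq_zero (Finset.mem_univ k), mul_zero]
      exact if_neg (Ne.symm hk)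
  show ∑ b', c b' * ∏ k, nsF (b' k) ((b k).castSucc) = c b
  simp [h]

lemma nsD_update {N e : ℕ} (c : (Fin N → Fin e) → ℝ) (k : Fin N) (a : Fin N → Fin (e + 1)) :
    ∑ t, nsD N e c (Function.update a k t) = 0 := by
  show ∑ t, ∑ b, c b * ∏ j, nsF (b j) (Function.update a k t j) = 0
  rw [Finset.sum_comm]
  refine Finset.sum_eq_zero fun b _ => ?_
  rw [← Finset.mul_sum]
  have h : ∀ t, ∏ j, nsF (b j) (Function.update a k t j)
      = nsF (b k) t * ∏ j ∈ Finset.univ.erase k, nsF (b j) (a j) := by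
    intro t
    rw [← Finset.mul_prod_erase _ _ (Finset.mem_univ k)]
    congr 1
    · simp
    · refine Finset.prod_congr rfl fun j hj => ?_
      rw [Function.update_of_ne (Finset.ne_of_mem_erase hj)]
  simp only [h, ← Finset.sum_mul, nsF_sum, zero_mul, mul_zero]

lemma nsD_sum {N e : ℕ} (hN : 1 ≤ N) (c : (Fin N → Fin e) → ℝ) :
    ∑ a, nsD N e c a = 0 := by
  show ∑ a : Fin N → Fin (e + 1), ∑ b, c b * ∏ j, nsF (b j) (a j) = 0
  rw [Finset.sum_comm]
  refine Finset.sum_eq_zero fun b _ => ?_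
  rw [← Finset.mul_sum]
  have h := Fintype.prod_sum (fun (j : Fin N) (t : Fin (e + 1)) => nsF (b j) t)
  rw [← h, Finset.prod_eq_zero (Finset.mem_univ (⟨0, hN⟩ : Fin N)) (nsF_sum _), mul_zero]

lemma ns_perturb {N M e : ℕ} (hN : 1 ≤ N) {P : (Fin N → Fin M) → (Fin N → Fin (e + 1)) → ℝ}
    (hP : P ∈ nsBehaviours N M (e + 1)) (x₀ : Fin N → Fin M) (c : (Fin N → Fin e) → ℝ)
    (r : ℝ) (hr : ∀ a, 0 ≤ P x₀ a + r * nsD N e c a) :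
    (fun x a => P x a + if x = x₀ then r * nsD N e c a else 0) ∈ nsBehaviours N M (e + 1) := by
  obtain ⟨h1, h2, h3⟩ := hP
  refine ⟨?_, ?_, ?_⟩
  · intro x a
    by_cases hx : x = x₀
    · subst hx; simpa using hr a
    · simpa [hx] using h1 x a
  · intro x
    by_cases hx : x = x₀
    · simp [hx, Finset.sum_add_distrib, ← Finset.mul_sum, nsD_sum hN, h2]
    · simp [hx, h2]
  · intro k x x' hxx a
    have h : ∀ y, ∑ t, (P y (Function.update a k t) +
        if y = x₀ then r * nsD N e c (Function.update a k t) else 0)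
        = ∑ t, P y (Function.update a k t) := by
      intro y
      by_cases hy : y = x₀
      · simp [hy, Finset.sum_add_distrib, ← Finset.mul_sum, nsD_update]
      · simp [hy]
    simp only [h]
    exact h3 k x x' hxx a

open Classical in
lemma ns_zeros {N M e : ℕ} (hN : 1 ≤ N) {P : (Fin N → Fin M) → (Fin N → Fin (e + 1)) → ℝ}
    (hP : P ∈ Set.extremePoints ℝ (nsBehaviours N M (e + 1))) (x₀ : Fin N → Fin M) :
    e ^ N ≤ Fintype.card {a // P x₀ a = 0} := by
  by_contra! hlt
  let L : ((Fin N → Fin e) → ℝ) →ₗ[ℝ] ({a // P x₀ a = 0} → ℝ) :=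
    (LinearMap.funLeft ℝ ℝ Subtype.val).comp (nsD N e)
  have hk : LinearMap.ker L ≠ ⊥ := LinearMap.ker_ne_bot_of_finrank_lt (by simpa using hlt)
  obtain ⟨c, hc, hc0⟩ := (Submodule.ne_bot_iff _).1 hk
  have hz : ∀ a, P x₀ a = 0 → nsD N e c a = 0 := fun a ha =>
    congrFun (LinearMap.mem_ker.1 hc) ⟨a, ha⟩
  obtain ⟨hPm, hPe⟩ := mem_extremePoints.1 hP
  have hev : ∀ᶠ r in nhdsWithin (0 : ℝ) (Set.Ioi 0), ∀ a, r * |nsD N e c a| ≤ P x₀ a := by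
    refine Filter.eventually_all.2 fun a => ?_
    rcases (hPm.1 x₀ a).eq_or_lt with h0 | h0
    · exact Filter.Eventually.of_forall fun r => by simp [hz a h0.symm, ← h0]
    · refine Filter.Eventually.filter_mono nhdsWithin_le_nhds ?_
      have ht : Filter.Tendsto (fun r : ℝ => r * |nsD N e c a|) (nhds 0) (nhds 0) := by
        have : Continuous (fun r : ℝ => r * |nsD N e c a|) := by fun_prop
        simpa using this.tendsto 0
      exact (ht.eventually_lt_const h0).mono fun r hr => hr.le
  obtain ⟨r, hr, hr0⟩ := (hev.and self_mem_nhdsWithin).exists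
  have hr0 : 0 < r := hr0
  have hab : ∀ a, |r * nsD N e c a| ≤ P x₀ a := fun a => by
    rw [abs_mul, abs_of_pos hr0]; exact hr a
  have m1 := ns_perturb hN hPm x₀ c r (fun a => by linarith [(abs_le.1 (hab a)).1])
  have m2 := ns_perturb hN hPm x₀ c (-r) (fun a => by linarith [(abs_le.1 (hab a)).2])
  have heq := hPe _ m1 _ m2 ⟨1/2, 1/2, by norm_num, by norm_num, by norm_num, by
    funext x a
    by_cases hx : x = x₀
    · simp [hx]; ring
    · simp [hx]; ring⟩
  apply hc0
  funext b
  have h := congrFun (congrFun heq.1 x₀) (fun k => (b k).castSucc)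
  simp only [if_true, nsD_castSucc] at h
  have : r * c b = 0 := by linarith
  simpa [hr0.ne'] using this

open Classical in
lemma ns_ext_bound {N M d : ℕ} (hN : 1 ≤ N) (hd : 1 ≤ d)
    {P : (Fin N → Fin M) → (Fin N → Fin d) → ℝ}
    (hP : P ∈ Set.extremePoints ℝ (nsBehaviours N M d)) (x₀ : Fin N → Fin M) :
    1 / ((d ^ N - (d - 1) ^ N : ℕ) : ℝ) ≤ ⨆ a : Fin N → Fin d, P x₀ a := by
  obtain ⟨e, rfl⟩ : ∃ e, d = e + 1 := ⟨d - 1, by omega⟩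
  have hz := ns_zeros hN hP x₀
  have hlt : e ^ N < (e + 1) ^ N := Nat.pow_lt_pow_left (by omega) (by omega)
  have hPm := hP.1
  set S := ⨆ a : Fin N → Fin (e + 1), P x₀ a with hS
  have hle : ∀ a, P x₀ a ≤ S := fun a => le_ciSup (Set.finite_range _).bddAbove a
  have hS0 : 0 ≤ S := (hPm.1 x₀ (fun _ => 0)).trans (hle _)
  have hsplit := Finset.card_filter_add_card_filter_not (s := Finset.univ)
    (fun a : Fin N → Fin (e + 1) => P x₀ a = 0)
  rw [Fintype.card_subtype] at hz
  have hcard : (Finset.univ.filter (fun a => ¬ P x₀ a = 0)).card ≤ (e + 1) ^ N - e ^ N := by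
    simp at hsplit
    omega
  have hsum : (1 : ℝ) ≤ ((e + 1) ^ N - e ^ N : ℕ) * S := by
    calc (1 : ℝ) = ∑ a, P x₀ a := (hPm.2.1 x₀).symm
      _ = ∑ a ∈ Finset.univ.filter (fun a => ¬ P x₀ a = 0), P x₀ a :=
        (Finset.sum_filter_ne_zero _).symm
      _ ≤ (Finset.univ.filter (fun a => ¬ P x₀ a = 0)).card • S :=
        Finset.sum_le_card_nsmul _ _ _ fun a _ => hle a
      _ ≤ _ := by
        rw [nsmul_eq_mul]
        exact mul_le_mul_of_nonneg_right (by exact_mod_cast hcard) hS0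
  rw [Nat.add_sub_cancel, div_le_iff₀' (by exact_mod_cast Nat.sub_pos_of_lt hlt)]
  exact hsum

/-- Maximally nonlocal theories cannot be maximally random: the guessing
probability of any finite convex decomposition of a no-signaling behaviour into
extreme points of the no-signaling set is at least `1 / (d^N - (d-1)^N)`. -/
theorem ns_not_maximally_random (N M d : ℕ) (hN : 1 ≤ N) (hM : 1 ≤ M) (hd : 1 ≤ d)
    (Pobs : (Fin N → Fin M) → (Fin N → Fin d) → ℝ)
    (hPobs : Pobs ∈ nsBehaviours N M d)
    (I : Type) [Fintype I]
    (q : I → ℝ) (Ps : I → (Fin N → Fin M) → (Fin N → Fin d) → ℝ)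
    (hq : ∀ i, 0 ≤ q i) (hqsum : ∑ i, q i = 1)
    (hext : ∀ i, Ps i ∈ Set.extremePoints ℝ (nsBehaviours N M d))
    (hdecomp : Pobs = ∑ i, q i • Ps i)
    (x₀ : Fin N → Fin M) :
    1 / ((d ^ N - (d - 1) ^ N : ℕ) : ℝ) ≤ ∑ i, q i * ⨆ a : Fin N → Fin d, Ps i x₀ a := by
  calc 1 / ((d ^ N - (d - 1) ^ N : ℕ) : ℝ)
      = ∑ i, q i * (1 / ((d ^ N - (d - 1) ^ N : ℕ) : ℝ)) := by
        rw [← Finset.sum_mul, hqsum, one_mul]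
    _ ≤ _ := Finset.sum_le_sum fun i _ =>
        mul_le_mul_of_nonneg_left (ns_ext_bound hN hd (hext i) x₀) (hq i)
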